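/- Let ρ_{AB} be a bipartite state and suppose there exists a quantum channel E : B→C (given by Kraus operators) such that the state ω_{AC} = (id_A⊗E)(ρ_{AB}) violates the reduction criterion, i.e., ρ_A⊗I_C − ω_{AC} is not positive semidefinite (where ρ_A = tr_B(ρ_{AB}) = tr_C(ω_{AC})). Then there exists a |C|-dimensional teleportation protocol (ρ_{AB}, {Π^i}, {D^i}) whose entanglement fidelity satisfies F(Λ) > 1/|C|. -/

import Mathlib

open Matrix BigOperators Finset
open scoped Kronecker ComplexOrder

noncomputable section

/-- Partial trace over the second tensor factor. -/
def ptraceB {α β : Type*} [Fintype β] (M : Matrix (α × β) (α × β) ℂ) :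
    Matrix α α ℂ :=
  Matrix.of fun a a' => ∑ b, M (a, b) (a', b)

/-- `ρ ↦ ∑ k (I ⊗ K k) ρ (I ⊗ K k)†`: a Kraus-operator channel `B → C` applied to the
second factor of a bipartite matrix on `A ⊗ B`. -/
def idKrausApply {a b c : ℕ} {m : ℕ} (K : Fin m → Matrix (Fin c) (Fin b) ℂ)
    (ρ : Matrix (Fin a × Fin b) (Fin a × Fin b) ℂ) :
    Matrix (Fin a × Fin c) (Fin a × Fin c) ℂ :=
  ∑ k, ((1 : Matrix (Fin a) (Fin a) ℂ) ⊗ₖ K k) * ρ *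
      ((1 : Matrix (Fin a) (Fin a) ℂ) ⊗ₖ K k)ᴴ

/-- The teleportation channel `Λ(σ) = ∑ i tr_{AC'}[(Πᵢ ⊗ I_C)(σ ⊗ ωᵢ)]`, written entrywise. -/
def teleChannel {a c N : ℕ}
    (Pv ω : Fin N → Matrix (Fin a × Fin c) (Fin a × Fin c) ℂ)
    (σ : Matrix (Fin c) (Fin c) ℂ) : Matrix (Fin c) (Fin c) ℂ :=
  Matrix.of fun x y =>
    ∑ i, ∑ a₁ : Fin a, ∑ x₁ : Fin c, ∑ a₂ : Fin a, ∑ x₂ : Fin c,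
      Pv i (a₁, x₁) (a₂, x₂) * σ x₂ x₁ * ω i (a₂, x) (a₁, y)

/-- The maximally entangled state `|Φ⁺⟩⟨Φ⁺|` with `|Φ⁺⟩ = c^{-1/2} ∑ᵢ |i⟩|i⟩`. -/
def maxEnt (c : ℕ) : Matrix (Fin c × Fin c) (Fin c × Fin c) ℂ :=
  Matrix.of fun p q => if p.1 = p.2 ∧ q.1 = q.2 then (1 : ℂ) / c else 0

/-- `(id ⊗ Λ)(M)`, written entrywise (this is the correct formula for linear `Λ`). -/
def idOnFirst {c d : ℕ} (Λ : Matrix (Fin c) (Fin c) ℂ → Matrix (Fin c) (Fin c) ℂ)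
    (M : Matrix (Fin d × Fin c) (Fin d × Fin c) ℂ) :
    Matrix (Fin d × Fin c) (Fin d × Fin c) ℂ :=
  Matrix.of fun p q => Λ (Matrix.of fun x y => M (p.1, x) (q.1, y)) p.2 q.2

/-- Entanglement fidelity `F(Λ) = tr[Φ⁺ (id ⊗ Λ)(Φ⁺)]` of the teleportation channel
determined by the POVM `Pv` and the encoded states `ω`. -/
def entFid {a c N : ℕ}
    (Pv ω : Fin N → Matrix (Fin a × Fin c) (Fin a × Fin c) ℂ) : ℂ :=
  Matrix.trace (maxEnt c * idOnFirst (teleChannel Pv ω) (maxEnt c))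

/-- Mutual information (base 2) of a joint probability distribution on a product of
finite sets; terms with `p x y = 0` vanish since `0 * log = 0`. -/
def mutInfo {X Y : Type*} [Fintype X] [Fintype Y] (p : X → Y → ℝ) : ℝ :=
  ∑ x, ∑ y, p x y * Real.logb 2 (p x y / ((∑ y', p x y') * (∑ x', p x' y)))

/-- Binary entropy (base 2). -/
def binEnt (p : ℝ) : ℝ := -(p * Real.logb 2 p) - (1 - p) * Real.logb 2 (1 - p)

/-- The swap operator on `ℂ^d ⊗ ℂ^d`. -/
def swapOp (d : ℕ) : Matrix (Fin d × Fin d) (Fin d × Fin d) ℂ :=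
  Matrix.of fun p q => if p.1 = q.2 ∧ p.2 = q.1 then 1 else 0

/-- The entanglement fidelity is `c⁻² ∑ᵢ tr(Πᵢ ωᵢ)`. -/
lemma entFid_eq_sum_trace {a c N : ℕ}
    (Pv ω : Fin N → Matrix (Fin a × Fin c) (Fin a × Fin c) ℂ) :
    entFid Pv ω = (1 / (c : ℂ)) * (1 / (c : ℂ)) * ∑ i, trace (Pv i * ω i) := by
  have key : ∀ p q : Fin c,
      teleChannel Pv ω (Matrix.of fun x y => maxEnt c (q, x) (p, y)) q p =
        (1 / (c : ℂ)) * ∑ i, ∑ a₁, ∑ a₂, Pv i (a₁, p) (a₂, q) * ω i (a₂, q) (a₁, p) := by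
    intro p q
    simp only [teleChannel, maxEnt, Matrix.of_apply, Finset.mul_sum]
    refine Finset.sum_congr rfl fun i _ => Finset.sum_congr rfl fun a₁ _ => ?_
    rw [Finset.sum_comm]
    refine Finset.sum_congr rfl fun a₂ _ => ?_
    rw [Finset.sum_eq_single p, Finset.sum_eq_single q]
    · simp only [and_self, if_true]; ring
    · intro x _ hx
      simp [hx.symm]
    · simp
    · intro x _ hx
      refine Finset.sum_eq_zero fun y _ => ?_
      simp [hx.symm]
    · simp
  have h1 : entFid Pv ω = ∑ p : Fin c, ∑ q : Fin c, (1 / (c : ℂ)) *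
      teleChannel Pv ω (Matrix.of fun x y => maxEnt c (q, x) (p, y)) q p := by
    simp only [entFid, trace, diag_apply, mul_apply, Fintype.sum_prod_type, idOnFirst,
      Matrix.of_apply]
    refine Finset.sum_congr rfl fun p _ => ?_
    rw [Finset.sum_eq_single p]
    · refine Finset.sum_congr rfl fun q _ => ?_
      rw [Finset.sum_eq_single q]
      · simp [maxEnt]
      · intro x _ hx
        simp [maxEnt, hx.symm]
      · simp
    · intro x _ hx
      refine Finset.sum_eq_zero fun y _ => Finset.sum_eq_zero fun z _ => ?_
      simp [maxEnt, hx.symm]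
    · simp
  rw [h1]
  simp only [key, trace, diag_apply, mul_apply, Fintype.sum_prod_type, Finset.mul_sum]
  simp only [← mul_assoc]
  calc _ = ∑ p : Fin c, ∑ i, ∑ q : Fin c, ∑ a₁ : Fin a, ∑ a₂ : Fin a,
        1 / (c : ℂ) * (1 / c) * Pv i (a₁, p) (a₂, q) * ω i (a₂, q) (a₁, p) :=
      Finset.sum_congr rfl fun p _ => Finset.sum_comm
    _ = ∑ i, ∑ p : Fin c, ∑ a₁ : Fin a, ∑ q : Fin c, ∑ a₂ : Fin a,
        1 / (c : ℂ) * (1 / c) * Pv i (a₁, p) (a₂, q) * ω i (a₂, q) (a₁, p) := by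
      rw [Finset.sum_comm]
      exact Finset.sum_congr rfl fun i _ => Finset.sum_congr rfl fun p _ => Finset.sum_comm
    _ = _ := by
      refine Finset.sum_congr rfl fun i _ => ?_
      rw [Finset.sum_comm]
      exact Finset.sum_congr rfl fun a₁ _ => Finset.sum_congr rfl fun p _ => Finset.sum_comm

lemma one_kronecker_conj_apply {a b c : ℕ} (K : Matrix (Fin c) (Fin b) ℂ)
    (ρ : Matrix (Fin a × Fin b) (Fin a × Fin b) ℂ) (s t : Fin a) (x x' : Fin c) :
    (((1 : Matrix (Fin a) (Fin a) ℂ) ⊗ₖ K) * ρ * ((1 : Matrix (Fin a) (Fin a) ℂ) ⊗ₖ K)ᴴ)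
      (s, x) (t, x') = ∑ y, ∑ y', K x y * star (K x' y') * ρ (s, y) (t, y') := by
  simp only [mul_apply, Fintype.sum_prod_type, conjTranspose_apply, kroneckerMap_apply,
    one_apply, ite_mul, one_mul, zero_mul, apply_ite star, star_zero, mul_ite, mul_zero]
  simp only [Finset.sum_ite_irrel, Finset.sum_const_zero, Finset.sum_ite_eq, Finset.mem_univ,
    if_true, Finset.sum_mul]
  rw [Finset.sum_comm]
  exact Finset.sum_congr rfl fun y _ => Finset.sum_congr rfl fun y' _ => by ring

/-- The Weyl–Heisenberg operators: a finite family of unitaries whose entries satisfy the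
orthogonality relations of a unitary 1-design. -/
lemma exists_unitary_design {c : ℕ} (hc : 0 < c) :
    ∃ U : ZMod c × ZMod c → Matrix (Fin c) (Fin c) ℂ, ∃ _ : Fintype (ZMod c),
      (∀ j, (U j)ᴴ * U j = 1) ∧
      ∀ x y x' y', ∑ j, U j x y * star (U j x' y') =
        if x = x' ∧ y = y' then (c : ℂ) else 0 := by
  have : NeZero c := ⟨hc.ne'⟩
  let e := ZMod.finEquiv c
  let χ := ZMod.stdAddChar (N := c)
  have hχ : ∀ z, star (χ z) = χ (-z) := fun z => (AddChar.map_neg_eq_conj χ z).symm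
  refine ⟨fun j => Matrix.of fun x y => if e x = e y + j.2 then χ (j.1 * e x) else 0,
    inferInstance, ?_, ?_⟩
  · intro j
    ext y y'
    simp only [mul_apply, conjTranspose_apply, Matrix.of_apply, one_apply]
    rw [Finset.sum_eq_single (e.symm (e y + j.2))]
    · by_cases h : y = y'
      · subst h
        simp [hχ, ← AddChar.map_add_eq_mul]
      · have : e y ≠ e y' := fun h' => h (e.injective h')
        simp [h, this]
    · intro x _ hx
      have : e x ≠ e y + j.2 := fun h => hx (by rw [← h]; simp)
      simp [this]
    · simp
  · intro x y x' y'
    simp only [Matrix.of_apply, Fintype.sum_prod_type]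
    have hs : ∀ k : ZMod c, ∑ s : ZMod c, (if e x = e y + s then χ (k * e x) else 0) *
        star (if e x' = e y' + s then χ (k * e x') else 0) =
        if e x - e y = e x' - e y' then χ (k * (e x - e x')) else 0 := by
      intro k
      rw [Finset.sum_eq_single (e x - e y)]
      · have h1 : (e x' = e y' + (e x - e y)) ↔ (e x - e y = e x' - e y') := by
          constructor <;> intro h <;> linear_combination -h
        simp only [h1, add_sub_cancel, if_true]
        split_ifs
        · rw [hχ, ← AddChar.map_add_eq_mul]; congr 1; ring
        · simp
      · intro s _ hs
        have : e x ≠ e y + s := fun h => hs (by rw [h]; ring)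
        simp [this]
      · simp
    simp only [hs]
    by_cases h : x = x'
    · subst h
      by_cases hy : y = y'
      · simp [hy, ZMod.card]
      · simp [hy]
    · have hne : e x - e x' ≠ 0 := fun h' => h (e.injective (sub_eq_zero.mp h'))
      have := AddChar.sum_mulShift (e x - e x') (ZMod.isPrimitive_stdAddChar c)
      simp only [hne, if_false, Nat.cast_zero] at this
      simp only [h, false_and, if_false, Finset.sum_ite_irrel, Finset.sum_const_zero]
      split_ifs
      · exact this
      · rfl

open scoped MatrixOrder Matrix.Norms.L2Operator in
lemma Matrix.IsHermitian.exists_one_sub_smul_posSemidef {n : Type*} [Fintype n] [DecidableEq n]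
    {A : Matrix n n ℂ} (hA : A.IsHermitian) :
    ∃ ε : ℝ, 0 < ε ∧ (1 - (ε : ℂ) • A).PosSemidef := by
  have hle : A ≤ algebraMap ℝ _ ‖A‖ := IsSelfAdjoint.le_algebraMap_norm_self hA
  have hpos : 0 < ‖A‖ + 1 := by positivity
  refine ⟨(‖A‖ + 1)⁻¹, inv_pos.mpr hpos, ?_⟩
  have h1 : (algebraMap ℝ (Matrix n n ℂ) ‖A‖ - A).PosSemidef := Matrix.le_iff.mp hle
  have h2 := (h1.add PosSemidef.one).smul (a := (((‖A‖ + 1)⁻¹ : ℝ) : ℂ))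
    (by exact_mod_cast (inv_pos.mpr hpos).le)
  convert h2 using 1
  have h3 : algebraMap ℝ (Matrix n n ℂ) ‖A‖ = (‖A‖ : ℂ) • 1 := by
    rw [Algebra.algebraMap_eq_smul_one]; ext i j; simp
  have hne : ((‖A‖ : ℂ) + 1) ≠ 0 := by exact_mod_cast hpos.ne'
  rw [h3]
  ext i j
  simp only [Matrix.sub_apply, Matrix.add_apply, Matrix.smul_apply, smul_eq_mul]
  push_cast
  field_simp
  ring

lemma idKrausApply_isHermitian {a b c m : ℕ} (K : Fin m → Matrix (Fin c) (Fin b) ℂ)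
    {ρ : Matrix (Fin a × Fin b) (Fin a × Fin b) ℂ} (hρ : ρ.IsHermitian) :
    (idKrausApply K ρ).IsHermitian := by
  simp only [idKrausApply, IsHermitian, conjTranspose_sum, conjTranspose_mul,
    conjTranspose_conjTranspose, hρ.eq, Matrix.mul_assoc]

lemma ptraceB_isHermitian {α β : Type*} [Fintype β] {M : Matrix (α × β) (α × β) ℂ}
    (hM : M.IsHermitian) : (ptraceB M).IsHermitian := by
  ext s t
  simp only [conjTranspose_apply, ptraceB, Matrix.of_apply, star_sum]
  exact Finset.sum_congr rfl fun y _ => hM.apply _ _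

lemma trace_mul_kronecker_one {a c : ℕ} (M : Matrix (Fin a × Fin c) (Fin a × Fin c) ℂ)
    (A : Matrix (Fin a) (Fin a) ℂ) :
    trace (M * (A ⊗ₖ (1 : Matrix (Fin c) (Fin c) ℂ))) = trace (ptraceB M * A) := by
  simp only [trace, diag_apply, mul_apply, Fintype.sum_prod_type, kroneckerMap_apply, one_apply,
    mul_ite, mul_one, mul_zero, Finset.sum_ite_eq', Finset.mem_univ, if_true, ptraceB,
    Matrix.of_apply, Finset.sum_mul]
  exact Finset.sum_congr rfl fun s _ => Finset.sum_comm

lemma idKrausApply_append {a b c m n : ℕ} (K : Fin m → Matrix (Fin c) (Fin b) ℂ)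
    (L : Fin n → Matrix (Fin c) (Fin b) ℂ) (ρ : Matrix (Fin a × Fin b) (Fin a × Fin b) ℂ) :
    idKrausApply (Fin.append K L) ρ = idKrausApply K ρ + idKrausApply L ρ := by
  simp [idKrausApply, Fin.sum_univ_add]

lemma idKrausApply_zero {a b c m : ℕ} (ρ : Matrix (Fin a × Fin b) (Fin a × Fin b) ℂ) :
    idKrausApply (fun _ : Fin m => (0 : Matrix (Fin c) (Fin b) ℂ)) ρ = 0 := by
  simp [idKrausApply]

/-- The channel that discards its input and prepares the basis state `i`. -/
lemma idKrausApply_single {a b c : ℕ} (i : Fin c)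
    (ρ : Matrix (Fin a × Fin b) (Fin a × Fin b) ℂ) :
    idKrausApply (fun k : Fin b => Matrix.single i k (1 : ℂ)) ρ =
      ptraceB ρ ⊗ₖ Matrix.single i i (1 : ℂ) := by
  ext ⟨s, x⟩ ⟨t, x'⟩
  simp only [idKrausApply, Matrix.sum_apply, one_kronecker_conj_apply, kroneckerMap_apply,
    ptraceB, Matrix.of_apply, Finset.sum_mul]
  refine Finset.sum_congr rfl fun k _ => ?_
  rw [Finset.sum_eq_single k, Finset.sum_eq_single k]
  · by_cases h : i = x <;> by_cases h' : i = x' <;> simp [Matrix.single_apply, h, h']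
  · intro y _ hy
    simp [Matrix.single_apply, hy.symm]
  · simp
  · intro y _ hy
    simp [Matrix.single_apply, hy.symm]
  · simp

lemma idKrausApply_mul_left {a b c m : ℕ} (U : Matrix (Fin c) (Fin c) ℂ)
    (K : Fin m → Matrix (Fin c) (Fin b) ℂ) (ρ : Matrix (Fin a × Fin b) (Fin a × Fin b) ℂ) :
    idKrausApply (fun k => U * K k) ρ =
      ((1 : Matrix (Fin a) (Fin a) ℂ) ⊗ₖ U) * idKrausApply K ρ *
        ((1 : Matrix (Fin a) (Fin a) ℂ) ⊗ₖ U)ᴴ := by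
  have h : ∀ k, (1 : Matrix (Fin a) (Fin a) ℂ) ⊗ₖ (U * K k) =
      ((1 : Matrix (Fin a) (Fin a) ℂ) ⊗ₖ U) * ((1 : Matrix (Fin a) (Fin a) ℂ) ⊗ₖ K k) := by
    intro k
    rw [← mul_kronecker_mul, Matrix.one_mul]
  simp only [idKrausApply, h, conjTranspose_mul, Matrix.mul_sum, Matrix.sum_mul, Matrix.mul_assoc]

/-- A 1-design twirl of the second factor produces the maximally mixed state there. -/
lemma sum_twirl {a c : ℕ} {J : Type*} [Fintype J] {U : J → Matrix (Fin c) (Fin c) ℂ}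
    (hU : ∀ x y x' y', ∑ j, U j x y * star (U j x' y') =
        if x = x' ∧ y = y' then (c : ℂ) else 0)
    (M : Matrix (Fin a × Fin c) (Fin a × Fin c) ℂ) :
    ∑ j, ((1 : Matrix (Fin a) (Fin a) ℂ) ⊗ₖ U j) * M *
        ((1 : Matrix (Fin a) (Fin a) ℂ) ⊗ₖ U j)ᴴ =
      (c : ℂ) • (ptraceB M ⊗ₖ (1 : Matrix (Fin c) (Fin c) ℂ)) := by
  ext ⟨s, x⟩ ⟨t, x'⟩
  simp only [Matrix.sum_apply, one_kronecker_conj_apply, Matrix.smul_apply, kroneckerMap_apply]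
  rw [Finset.sum_comm]
  have h : ∀ y, ∑ j, ∑ y', U j x y * star (U j x' y') * M (s, y) (t, y') =
      if x = x' then (c : ℂ) * M (s, y) (t, y) else 0 := by
    intro y
    rw [Finset.sum_comm]
    simp only [← Finset.sum_mul, hU]
    by_cases hx : x = x' <;> simp [hx]
  simp only [h]
  by_cases hx : x = x' <;> simp [hx, ptraceB, Finset.mul_sum, one_apply]

/-- A protocol with messages in an arbitrary finite type, reindexed by `Fin N`. -/
lemma exists_protocol_of_sum_trace_gt {a b c m' : ℕ} (hc : 0 < c) {ι : Type*} [Fintype ι]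
    (ρ : Matrix (Fin a × Fin b) (Fin a × Fin b) ℂ)
    (P : ι → Matrix (Fin a × Fin c) (Fin a × Fin c) ℂ)
    (K : ι → Fin m' → Matrix (Fin c) (Fin b) ℂ)
    (hP : ∀ i, (P i).PosSemidef) (hsum : ∑ i, P i = 1)
    (hK : ∀ i, ∑ k, (K i k)ᴴ * K i k = 1)
    (hlt : (c : ℂ) < ∑ i, trace (P i * idKrausApply (K i) ρ)) :
    ∃ (N m' : ℕ) (Pv : Fin N → Matrix (Fin a × Fin c) (Fin a × Fin c) ℂ)
      (K : Fin N → Fin m' → Matrix (Fin c) (Fin b) ℂ),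
      (∀ i, (Pv i).PosSemidef) ∧ (∑ i, Pv i = 1) ∧
        (∀ i, ∑ k, (K i k)ᴴ * K i k = 1) ∧
        1 / (c : ℂ) < entFid Pv (fun i => idKrausApply (K i) ρ) := by
  let e := (Fintype.equivFin ι).symm
  refine ⟨Fintype.card ι, m', P ∘ e, K ∘ e, fun i => hP _, ?_, fun i => hK _, ?_⟩
  · rw [← hsum]
    exact e.sum_comp P
  · have h : ∑ i, trace ((P ∘ e) i * idKrausApply ((K ∘ e) i) ρ) =
        ∑ i, trace (P i * idKrausApply (K i) ρ) :=
      e.sum_comp fun i => trace (P i * idKrausApply (K i) ρ)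
    rw [entFid_eq_sum_trace, h]
    have hc' : (0 : ℂ) < 1 / (c : ℂ) * (1 / (c : ℂ)) := by
      have : (0 : ℝ) < 1 / (c : ℝ) * (1 / (c : ℝ)) := by positivity
      have h := Complex.zero_lt_real.mpr this
      push_cast at h
      exact h
    have hne : (c : ℂ) ≠ 0 := by exact_mod_cast hc.ne'
    calc 1 / (c : ℂ) = 1 / (c : ℂ) * (1 / (c : ℂ)) * c := by field_simp
      _ < _ := mul_lt_mul_of_pos_left hlt hc'

/-- if some channel `E : B → C` produces `ω = (id ⊗ E)(ρ)` violating the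
reduction criterion, then there is a `|C|`-dimensional teleportation protocol using `ρ`
with entanglement fidelity strictly greater than `1/|C|`. -/
theorem stmt_5 {a b c : ℕ} (hc : 0 < c)
    (ρ : Matrix (Fin a × Fin b) (Fin a × Fin b) ℂ)
    (hρ : ρ.PosSemidef) (hρtr : ρ.trace = 1)
    (m : ℕ) (E : Fin m → Matrix (Fin c) (Fin b) ℂ)
    (hE : ∑ k, (E k)ᴴ * E k = 1)
    (hviol : ¬ ((ptraceB ρ) ⊗ₖ (1 : Matrix (Fin c) (Fin c) ℂ) -
        idKrausApply E ρ).PosSemidef) :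
    ∃ (N m' : ℕ) (Pv : Fin N → Matrix (Fin a × Fin c) (Fin a × Fin c) ℂ)
      (K : Fin N → Fin m' → Matrix (Fin c) (Fin b) ℂ),
      (∀ i, (Pv i).PosSemidef) ∧ (∑ i, Pv i = 1) ∧
        (∀ i, ∑ k, (K i k)ᴴ * K i k = 1) ∧
        1 / (c : ℂ) < entFid Pv (fun i => idKrausApply (K i) ρ) := by
  have hρA := ptraceB_isHermitian hρ.isHermitian
  have hherm : ((ptraceB ρ) ⊗ₖ (1 : Matrix (Fin c) (Fin c) ℂ) - idKrausApply E ρ).IsHermitian := by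
    refine IsHermitian.sub ?_ (idKrausApply_isHermitian E hρ.isHermitian)
    rw [IsHermitian, conjTranspose_kronecker, hρA.eq, conjTranspose_one]
  set ω := idKrausApply E ρ with hω
  set ρA := ptraceB ρ with hρA'
  -- a vector witnessing the violation
  obtain ⟨ψ, hψ⟩ : ∃ ψ : Fin a × Fin c → ℂ,
      star ψ ⬝ᵥ ((ρA ⊗ₖ (1 : Matrix (Fin c) (Fin c) ℂ) - ω) *ᵥ ψ) < 0 := by
    by_contra! hcon
    refine hviol (PosSemidef.of_dotProduct_mulVec_nonneg hherm fun ψ => ?_)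
    have him := hherm.im_star_dotProduct_mulVec_self ψ
    have h := hcon ψ
    rw [Complex.lt_def] at h
    rw [Complex.le_def]
    refine ⟨?_, him.symm⟩
    by_contra hlt
    exact h ⟨lt_of_not_ge hlt, him⟩
  set Ψ := vecMulVec ψ (star ψ) with hΨ
  have hΨpos : Ψ.PosSemidef := posSemidef_vecMulVec_self_star ψ
  have htr : ∀ X : Matrix (Fin a × Fin c) (Fin a × Fin c) ℂ,
      trace (Ψ * X) = star ψ ⬝ᵥ (X *ᵥ ψ) := by
    intro X
    rw [trace_mul_comm, hΨ, mul_vecMulVec, trace_vecMulVec, dotProduct_comm]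
  have hneg : trace (ptraceB Ψ * ρA) - trace (Ψ * ω) < 0 := by
    rw [← trace_mul_kronecker_one, ← trace_sub, ← Matrix.mul_sub, htr]
    exact hψ
  obtain ⟨δ, hδ, hpos⟩ := (ptraceB_isHermitian hΨpos.isHermitian).exists_one_sub_smul_posSemidef
  have hcne : (c : ℂ) ≠ 0 := by exact_mod_cast hc.ne'
  obtain ⟨U, _, hU, hdesign⟩ := exists_unitary_design hc
  set V := fun j => (1 : Matrix (Fin a) (Fin a) ℂ) ⊗ₖ U j with hV
  have hVunit : ∀ j, (V j)ᴴ * V j = 1 := by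
    intro j
    rw [hV, conjTranspose_kronecker, ← mul_kronecker_mul, hU, conjTranspose_one, Matrix.one_mul,
      one_kronecker_one]
  have hδc : (0 : ℂ) ≤ (δ : ℂ) / c := by
    have : 0 ≤ δ / (c : ℝ) := by positivity
    exact_mod_cast this
  set B := (1 : Matrix (Fin a) (Fin a) ℂ) - (δ : ℂ) • ptraceB Ψ with hB
  have hcard : ∑ _j : ZMod c × ZMod c, (1 : ℂ) = (c : ℂ) * c := by
    have : NeZero c := ⟨hc.ne'⟩
    simp [ZMod.card]
  have hsingle : ∑ i : Fin c, Matrix.single i i (1 : ℂ) = 1 := by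
    ext x y
    simp [Matrix.sum_apply, Matrix.single_apply, one_apply, ite_and]
  refine exists_protocol_of_sum_trace_gt hc (ι := (ZMod c × ZMod c) ⊕ Fin c) (m' := m + b) ρ
    (Sum.elim (fun j => ((δ : ℂ) / c) • (V j * Ψ * (V j)ᴴ))
      fun i => B ⊗ₖ Matrix.single i i (1 : ℂ))
    (Sum.elim (fun j => Fin.append (fun k => U j * E k) fun _ => 0)
      fun i => Fin.append (fun _ => 0) fun k => Matrix.single i k (1 : ℂ)) ?_ ?_ ?_ ?_
  · rintro (j | i)
    · exact (hΨpos.mul_mul_conjTranspose_same _).smul hδc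
    · refine hpos.kronecker ?_
      rw [← diagonal_single, posSemidef_diagonal_iff]
      intro k
      by_cases h : k = i
      · subst h; simp
      · simp [h]
  · simp only [Fintype.sum_sum_type, Sum.elim_inl, Sum.elim_inr, ← Finset.smul_sum, hV]
    rw [sum_twirl hdesign, smul_smul, div_mul_cancel₀ _ hcne]
    ext ⟨s, x⟩ ⟨t, x'⟩
    have := congrFun (congrFun hsingle x) x'
    rw [Matrix.sum_apply] at this
    simp only [Matrix.add_apply, Matrix.sum_apply, Matrix.smul_apply, kroneckerMap_apply,
      ← Finset.mul_sum, this, hB, Matrix.sub_apply, smul_eq_mul]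
    rw [← one_kronecker_one (α := ℂ) (m := Fin a) (n := Fin c), kroneckerMap_apply]
    ring
  · rintro (j | i)
    · simp only [Sum.elim_inl, Fin.sum_univ_add, Fin.append_left, Fin.append_right,
        conjTranspose_mul, Matrix.mul_zero, Finset.sum_const_zero, add_zero]
      rw [← hE]
      refine Finset.sum_congr rfl fun k _ => ?_
      rw [Matrix.mul_assoc, ← Matrix.mul_assoc (U j)ᴴ, hU, Matrix.one_mul]
    · simp only [Sum.elim_inr, Fin.sum_univ_add, Fin.append_left, Fin.append_right,
        Matrix.mul_zero, Finset.sum_const_zero, zero_add]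
      ext x y
      simp [Matrix.sum_apply, Matrix.single_apply, one_apply, ite_and]
  · have hquantum : ∀ j, trace ((((δ : ℂ) / c) • (V j * Ψ * (V j)ᴴ)) *
        (V j * ω * (V j)ᴴ)) = ((δ : ℂ) / c) * trace (Ψ * ω) := by
      intro j
      have : V j * Ψ * (V j)ᴴ * (V j * ω * (V j)ᴴ) = V j * (Ψ * ω * (V j)ᴴ) := by
        calc _ = V j * Ψ * ((V j)ᴴ * V j) * ω * (V j)ᴴ := by simp only [Matrix.mul_assoc]
          _ = _ := by rw [hVunit]; simp only [Matrix.mul_assoc, Matrix.one_mul]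
      rw [smul_mul_assoc, trace_smul, this, trace_mul_comm, Matrix.mul_assoc, hVunit,
        Matrix.mul_one, smul_eq_mul]
    have hclassical : ∀ i : Fin c, trace ((B ⊗ₖ Matrix.single i i (1 : ℂ)) *
        (ρA ⊗ₖ Matrix.single i i (1 : ℂ))) = trace (B * ρA) := by
      intro i
      rw [← mul_kronecker_mul, trace_kronecker]
      simp
    have hρAtr : trace ρA = 1 := by
      rw [← hρtr]
      simp [trace, hρA', ptraceB, Fintype.sum_prod_type]
    have hBtr : trace (B * ρA) = 1 - δ * trace (ptraceB Ψ * ρA) := by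
      rw [hB, Matrix.sub_mul, Matrix.one_mul, trace_sub, hρAtr, smul_mul_assoc, trace_smul,
        smul_eq_mul]
    simp only [Fintype.sum_sum_type, Sum.elim_inl, Sum.elim_inr, idKrausApply_append,
      idKrausApply_zero, add_zero, zero_add, idKrausApply_mul_left, idKrausApply_single]
    have e1 : ∑ j, trace ((((δ : ℂ) / c) • (V j * Ψ * (V j)ᴴ)) * (V j * ω * (V j)ᴴ)) =
        c * δ * trace (Ψ * ω) := by
      calc _ = (∑ _j : ZMod c × ZMod c, (1 : ℂ)) * (((δ : ℂ) / c) * trace (Ψ * ω)) := by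
            rw [Finset.sum_mul]
            exact Finset.sum_congr rfl fun j _ => by rw [hquantum, one_mul]
        _ = _ := by rw [hcard]; field_simp
    have e2 : ∑ i : Fin c, trace ((B ⊗ₖ Matrix.single i i (1 : ℂ)) *
        (ρA ⊗ₖ Matrix.single i i (1 : ℂ))) = c * (1 - δ * trace (ptraceB Ψ * ρA)) := by
      simp only [hclassical, hBtr, Finset.sum_const, Finset.card_univ, Fintype.card_fin,
        nsmul_eq_mul]
    have hcδ : (0 : ℂ) < c * δ := by
      have : 0 < (c : ℝ) * δ := by positivity
      exact_mod_cast this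
    calc (c : ℂ) < c + c * δ * -(trace (ptraceB Ψ * ρA) - trace (Ψ * ω)) :=
          lt_add_of_pos_right _ (mul_pos hcδ (neg_pos.mpr hneg))
      _ = c * δ * trace (Ψ * ω) + c * (1 - δ * trace (ptraceB Ψ * ρA)) := by ring
      _ = _ := by rw [← e1, ← e2]
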